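/- Fix n ≥ 3 and let B₁, …, B_{n−1} be the reduced Burau matrices over the Laurent polynomial ring ℤ[t,t⁻¹]. Then (B₁ B₂ ⋯ B_{n−1})ⁿ = tⁿ · I_{n−1}; that is, the image of the full twist braid τ_n = (σ₁⋯σ_{n−1})ⁿ under the reduced Burau representation is the scalar matrix tⁿ · I_{n−1}. -/

import Mathlib

open Matrix

/-- The reduced Burau matrix of the generator `σ_{k+1}` of `B_n`, over a commutative ring `R`
with parameter `t`.  Row `k` has entries `t, -t, 1` in columns `k-1, k, k+1` (when present);
all other rows are the corresponding rows of the identity matrix. -/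
def burauMatrix (n : ℕ) (R : Type*) [CommRing R] (t : R) (k : Fin (n - 1)) :
    Matrix (Fin (n - 1)) (Fin (n - 1)) R :=
  Matrix.of fun r c =>
    if r = k then
      if (c : ℕ) + 1 = (k : ℕ) then t
      else if c = k then -t
      else if (c : ℕ) = (k : ℕ) + 1 then 1
      else 0
    else if r = c then 1 else 0

/-- Vectors indexed by `Fin (n - 1)` are written as `i ↦ g (i + 1)`, so that the boundary
conditions `g 0 = 0` and `g n = 0` account for the missing columns of the extreme matrices. -/
lemma burauMatrix_mulVec {n : ℕ} {R : Type*} [CommRing R] (t : R) (k : Fin (n - 1))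
    (g : ℕ → R) (g_zero : g 0 = 0) (g_last : g n = 0) :
    burauMatrix n R t k *ᵥ (fun i => g (i + 1)) =
      fun i => if i = k then t * g k - t * g (k + 1) + g (k + 2) else g (i + 1) := by
  ext r
  by_cases hr : r = k
  · subst hr
    have entry (c : Fin (n - 1)) : burauMatrix n R t r r c * g (c + 1) =
        (if (c : ℕ) + 1 = r then t * g (c + 1) else 0) +
        (if (c : ℕ) = r then -t * g (c + 1) else 0) +
        (if (c : ℕ) = r + 1 then g (c + 1) else 0) := by
      simp only [burauMatrix, Matrix.of_apply, if_true, Fin.ext_iff]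
      split_ifs <;> first | omega | simp
    have hprev : ∑ c ∈ Finset.range (n - 1), (if c + 1 = (r : ℕ) then t * g (c + 1) else 0) =
        t * g r := by
      obtain ⟨r, hr⟩ := r
      cases r with
      | zero => simp [g_zero]
      | succ r => simp [show r < n - 1 by omega]
    have hnext : (if (r : ℕ) + 1 < n - 1 then g (r + 1 + 1) else 0) = g (r + 2) := by
      split_ifs with h
      · rfl
      · rw [show (r : ℕ) + 2 = n by omega, g_last]
    simp only [Matrix.mulVec, dotProduct, entry, if_true]
    rw [Fin.sum_univ_eq_sum_range (fun c => (if c + 1 = (r : ℕ) then t * g (c + 1) else 0) +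
      (if c = (r : ℕ) then -t * g (c + 1) else 0) +
      (if c = (r : ℕ) + 1 then g (c + 1) else 0)) (n - 1)]
    simp only [Finset.sum_add_distrib, hprev, Finset.sum_ite_eq', Finset.mem_range, r.isLt,
      if_true, hnext]
    ring
  · simp [Matrix.mulVec, dotProduct, burauMatrix, hr]

/-- The action of the tail `B_{s+1} ⋯ B_{n-1}` of the Burau product. -/
lemma burauMatrix_prod_drop_mulVec {n : ℕ} {R : Type*} [CommRing R] (t : R)
    (g : ℕ → R) (g_zero : g 0 = 0) {s : ℕ} (hs : s ≤ n - 1) :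
    ((List.ofFn (burauMatrix n R t)).drop s).prod *ᵥ (fun i => g (i + 1)) =
      fun i : Fin (n - 1) =>
        if (i : ℕ) + 1 ≤ s then g (i + 1) else t * (g i - g (n - 1)) := by
  induction hs using Nat.decreasingInduction with
  | self =>
    rw [List.drop_of_length_le (by simp)]
    ext i
    simp [show (i : ℕ) + 1 ≤ n - 1 by omega]
  | of_succ s hs ih =>
    rw [List.drop_eq_getElem_cons (by simpa using hs), List.prod_cons, ← Matrix.mulVec_mulVec, ih,
      List.getElem_ofFn]
    have h := burauMatrix_mulVec t ⟨s, hs⟩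
      (fun x => if x ≤ s + 1 then g x else t * (g (x - 1) - g (n - 1))) (by simp [g_zero])
      (by simp [show ¬ n ≤ s + 1 by omega])
    simp only [Nat.add_sub_cancel] at h
    rw [h]
    ext i
    rcases lt_trichotomy (i : ℕ) s with hi | hi | hi
    · simp [Fin.ext_iff, hi.ne, show (i : ℕ) ≤ s by omega, show (i : ℕ) + 1 ≤ s by omega]
    · simp [Fin.ext_iff, hi]
      ring
    · simp [Fin.ext_iff, hi.ne', show ¬ (i : ℕ) ≤ s by omega, show ¬ (i : ℕ) + 1 ≤ s by omega]

lemma burauMatrix_prod_mulVec {n : ℕ} {R : Type*} [CommRing R] (t : R)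
    (g : ℕ → R) (g_zero : g 0 = 0) :
    (List.ofFn (burauMatrix n R t)).prod *ᵥ (fun i => g (i + 1)) =
      fun i : Fin (n - 1) => t * (g i - g (n - 1)) := by
  simpa using burauMatrix_prod_drop_mulVec t g g_zero (Nat.zero_le (n - 1))

/-- On an `n`-periodic sequence the Burau product acts as a rotation, up to the factor `t` and
an additive normalization. -/
lemma burauMatrix_prod_pow_mulVec {n : ℕ} (hn : 0 < n) {R : Type*} [CommRing R] (t : R)
    (g : ℕ → R) (g_zero : g 0 = 0) (g_periodic : Function.Periodic g n) (j : ℕ) :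
    (List.ofFn (burauMatrix n R t)).prod ^ j *ᵥ (fun i => g (i + 1)) =
      fun i : Fin (n - 1) => t ^ j * (g (i + 1 + (n - 1) * j) - g ((n - 1) * j)) := by
  induction j with
  | zero => simp [g_zero]
  | succ j ih =>
    rw [pow_succ', ← Matrix.mulVec_mulVec, ih, burauMatrix_prod_mulVec t
      (fun x => t ^ j * (g (x + (n - 1) * j) - g ((n - 1) * j))) (by simp)]
    ext i
    have hshift : (i : ℕ) + 1 + (n - 1) * (j + 1) = i + (n - 1) * j + n := by
      rw [Nat.mul_succ]
      omega
    rw [hshift, g_periodic, show (n - 1) * (j + 1) = n - 1 + (n - 1) * j by ring]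
    ring

theorem burauMatrix_prod_pow_eq_smul_one {n : ℕ} (hn : 0 < n) {R : Type*} [CommRing R] (t : R) :
    (List.ofFn (burauMatrix n R t)).prod ^ n = t ^ n • (1 : Matrix _ _ R) := by
  refine Matrix.ext_of_mulVec_single fun c => ?_
  let g : ℕ → R := fun x => if x % n = c + 1 then 1 else 0
  have g_periodic : Function.Periodic g n := fun x => by simp [g]
  have g_zero : g 0 = 0 := by simp [g]
  have hsingle : Pi.single c 1 = fun i : Fin (n - 1) => g (i + 1) := by
    ext i
    simp [g, Pi.single_apply, Fin.ext_iff, Nat.mod_eq_of_lt (show (i : ℕ) + 1 < n by omega)]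
  rw [hsingle, burauMatrix_prod_pow_mulVec hn t g g_zero g_periodic]
  ext i
  have hrot : g ((n - 1) * n) = 0 := by simp [g]
  have hper : g (i + 1 + (n - 1) * n) = g (i + 1) := by simp [g]
  rw [hrot, hper, Matrix.smul_mulVec, Matrix.one_mulVec]
  simp

/-- The image of the full twist `τ_n = (σ₁⋯σ_{n-1})ⁿ` under the reduced Burau representation
over `ℤ[t,t⁻¹]` is the scalar matrix `tⁿ · I_{n-1}`. -/
theorem burau_fullTwist_eq_scalar (n : ℕ) (hn : 3 ≤ n) :
    ((List.ofFn fun i : Fin (n - 1) =>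
      burauMatrix n (LaurentPolynomial ℤ) (LaurentPolynomial.T 1) i).prod) ^ n =
    ((LaurentPolynomial.T 1 : LaurentPolynomial ℤ)) ^ n •
      (1 : Matrix (Fin (n - 1)) (Fin (n - 1)) (LaurentPolynomial ℤ)) :=
  burauMatrix_prod_pow_eq_smul_one (by omega) _
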